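/- Let ξ ∈ (0,1). For every θ ∈ ℝ the improper Riemann integral Lb_ξ(θ) = lim_{T→∞} ∫₀^T cos(τ³/3 + θτ + ξπ/2) τ^{−ξ} dτ exists, the resulting function Lb_ξ : ℝ → ℝ is three times differentiable, and it solves Langer's equation: Lb_ξ'''(θ) = θ·Lb_ξ'(θ) + (1−ξ)·Lb_ξ(θ) for all θ ∈ ℝ. -/

import Mathlib

open Real Filter

/-- The integrand `s ^ (b - 1) * exp (-s ^ 3 / 3 + z * s)` of a cubic Laplace-type integral over
`s ∈ (0, ∞)`, written in the logarithmic variable `x = log s`. -/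
noncomputable def cubicLaplaceKernel (b : ℝ) (z : ℂ) (x : ℝ) : ℂ :=
  Complex.exp (((b * x - rexp x ^ 3 / 3 : ℝ) : ℂ) + z * (rexp x : ℝ))

/-- The integral `∫₀^∞ s ^ (b - 1) * exp (-s ^ 3 / 3 + z * s) ds`. -/
noncomputable def cubicLaplace (b : ℝ) (z : ℂ) : ℂ :=
  ∫ x : ℝ, cubicLaplaceKernel b z x

lemma norm_cubicLaplaceKernel (b : ℝ) (z : ℂ) (x : ℝ) :
    ‖cubicLaplaceKernel b z x‖ = rexp (b * x - rexp x ^ 3 / 3 + z.re * rexp x) := by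
  rw [cubicLaplaceKernel, Complex.norm_exp, Complex.add_re, Complex.ofReal_re,
    Complex.re_mul_ofReal]

lemma continuous_cubicLaplaceKernel (b : ℝ) (z : ℂ) : Continuous (cubicLaplaceKernel b z) := by
  unfold cubicLaplaceKernel
  fun_prop

lemma exp_mul_cubicLaplaceKernel (b : ℝ) (z : ℂ) (x : ℝ) :
    (rexp x : ℂ) * cubicLaplaceKernel b z x = cubicLaplaceKernel (b + 1) z x := by
  rw [cubicLaplaceKernel, cubicLaplaceKernel, Complex.ofReal_exp x, ← Complex.exp_add]
  congr 1
  push_cast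
  ring

lemma mul_sub_cube_div_three_le {N u : ℝ} (hN : 0 ≤ N) (hu : 0 ≤ u) :
    N * u - u ^ 3 / 3 ≤ N * (3 * N + 1) := by
  rcases le_total u (3 * N + 1) with h | h
  · nlinarith [mul_le_mul_of_nonneg_left h hN, pow_nonneg hu 3]
  · have h2 : 3 * N ≤ u ^ 2 := by nlinarith
    nlinarith [mul_le_mul_of_nonneg_right h2 hu, mul_nonneg hN hN]

lemma norm_cubicLaplaceKernel_le {b M : ℝ} (hb : 0 < b) (hM : 0 ≤ M) {z : ℂ} (hz : ‖z‖ ≤ M)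
    (x : ℝ) :
    ‖cubicLaplaceKernel b z x‖ ≤
      rexp ((2 * b + M) * (3 * (2 * b + M) + 1) + M) * rexp (-b * |x|) := by
  rw [norm_cubicLaplaceKernel, ← Real.exp_add, Real.exp_le_exp]
  have hre : z.re * rexp x ≤ M * rexp x := by
    gcongr
    exact (Complex.re_le_norm z).trans hz
  have hu := Real.exp_pos x
  rcases le_total 0 x with hx | hx
  · rw [abs_of_nonneg hx]
    have h1 := mul_sub_cube_div_three_le (N := 2 * b + M) (by positivity) hu.le
    have h2 : b * x ≤ b * rexp x := by
      gcongr
      linarith [Real.add_one_le_exp x]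
    linarith
  · rw [abs_of_nonpos hx]
    have h1 : M * rexp x ≤ M * 1 := by
      gcongr
      exact Real.exp_le_one_iff.2 hx
    have h2 : 0 ≤ (2 * b + M) * (3 * (2 * b + M) + 1) := by positivity
    have h3 := pow_pos hu 3
    linarith

lemma integrable_exp_neg_mul_abs {b : ℝ} (hb : 0 < b) :
    MeasureTheory.Integrable (fun x : ℝ => rexp (-b * |x|)) := by
  rw [← MeasureTheory.integrableOn_univ, ← Set.Iic_union_Ioi (a := (0 : ℝ))]
  refine MeasureTheory.IntegrableOn.union ?_ ?_
  · refine (integrableOn_exp_mul_Iic hb 0).congr_fun (fun x hx => ?_) measurableSet_Iic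
    simp [abs_of_nonpos (Set.mem_Iic.1 hx)]
  · refine (integrableOn_exp_mul_Ioi (neg_lt_zero.2 hb) 0).congr_fun (fun x hx => ?_)
      measurableSet_Ioi
    simp [abs_of_pos (Set.mem_Ioi.1 hx)]

lemma integrable_cubicLaplaceKernel {b : ℝ} (hb : 0 < b) (z : ℂ) :
    MeasureTheory.Integrable (cubicLaplaceKernel b z) :=
  ((integrable_exp_neg_mul_abs hb).const_mul _).mono'
    (continuous_cubicLaplaceKernel b z).aestronglyMeasurable
    (.of_forall (norm_cubicLaplaceKernel_le hb (norm_nonneg z) le_rfl))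

lemma tendsto_cubicLaplaceKernel {b : ℝ} (hb : 0 < b) (z : ℂ) {l : Filter ℝ}
    (hl : Tendsto (fun x : ℝ => |x|) l atTop) :
    Tendsto (cubicLaplaceKernel b z) l (nhds 0) := by
  refine squeeze_zero_norm (norm_cubicLaplaceKernel_le hb (norm_nonneg z) le_rfl) ?_
  rw [← mul_zero (rexp _)]
  exact (Real.tendsto_exp_atBot.comp (hl.const_mul_atTop_of_neg (neg_lt_zero.2 hb))).const_mul _

lemma hasDerivAt_cubicLaplace {b : ℝ} (hb : 0 < b) (z : ℂ) :
    HasDerivAt (cubicLaplace b) (cubicLaplace (b + 1) z) z := by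
  refine (hasDerivAt_integral_of_dominated_loc_of_deriv_le (Metric.ball_mem_nhds z one_pos)
    (.of_forall fun w => (continuous_cubicLaplaceKernel b w).aestronglyMeasurable)
    (integrable_cubicLaplaceKernel hb z)
    (continuous_cubicLaplaceKernel (b + 1) z).aestronglyMeasurable
    (.of_forall fun x w hw => norm_cubicLaplaceKernel_le (M := ‖z‖ + 1) (by positivity)
      (by positivity) ?_ x)
    ((integrable_exp_neg_mul_abs (by positivity)).const_mul _)
    (.of_forall fun x w _ => ?_)).2
  · have := norm_sub_norm_le w z
    rw [mem_ball_iff_norm] at hw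
    linarith
  · rw [← exp_mul_cubicLaplaceKernel, mul_comm]
    exact (((hasDerivAt_id w).mul_const (rexp x : ℂ)).const_add _).cexp.congr_deriv
      (by simp [cubicLaplaceKernel])

lemma hasDerivAt_cubicLaplaceKernel (b : ℝ) (z : ℂ) (x : ℝ) :
    HasDerivAt (cubicLaplaceKernel b z)
      (b * cubicLaplaceKernel b z x - cubicLaplaceKernel (b + 3) z x +
        z * cubicLaplaceKernel (b + 1) z x) x := by
  have h3 : cubicLaplaceKernel (b + 3) z x = (rexp x : ℂ) ^ 3 * cubicLaplaceKernel b z x := by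
    rw [show b + 3 = b + 1 + 1 + 1 by ring]
    simp only [← exp_mul_cubicLaplaceKernel]
    ring
  rw [h3, ← exp_mul_cubicLaplaceKernel]
  have h1 : HasDerivAt (fun y : ℝ => b * y - rexp y ^ 3 / 3) (b - rexp x ^ 3) x := by
    refine (((hasDerivAt_id x).const_mul b).sub
      (((Real.hasDerivAt_exp x).pow 3).div_const 3)).congr_deriv ?_
    simp
    ring
  refine (h1.ofReal_comp.add ((Real.hasDerivAt_exp x).ofReal_comp.const_mul z)).cexp.congr_deriv ?_
  simp only [cubicLaplaceKernel, Pi.add_apply]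
  push_cast
  ring

lemma cubicLaplace_add_three {b : ℝ} (hb : 0 < b) (z : ℂ) :
    cubicLaplace (b + 3) z = z * cubicLaplace (b + 1) z + b * cubicLaplace b z := by
  have i0 := (integrable_cubicLaplaceKernel hb z).const_mul (b : ℂ)
  have i1 := (integrable_cubicLaplaceKernel (add_pos hb one_pos) z).const_mul z
  have i3 := integrable_cubicLaplaceKernel (add_pos hb three_pos) z
  have h := MeasureTheory.integral_of_hasDerivAt_of_tendsto (hasDerivAt_cubicLaplaceKernel b z)
    ((i0.sub i3).add i1) (tendsto_cubicLaplaceKernel hb z tendsto_abs_atBot_atTop)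
    (tendsto_cubicLaplaceKernel hb z tendsto_abs_atTop_atTop)
  rw [MeasureTheory.integral_add (f := fun x => b * cubicLaplaceKernel b z x -
      cubicLaplaceKernel (b + 3) z x) (i0.sub i3) i1, MeasureTheory.integral_sub i0 i3,
    MeasureTheory.integral_const_mul, MeasureTheory.integral_const_mul] at h
  simp only [cubicLaplace]
  linear_combination -h

/-- The integrand `s ^ (b - 1) * exp (i * (s ^ 3 / 3 + θ * s))` in the logarithmic variable
`w = log s`. -/
noncomputable def langerKernel (b θ : ℝ) (w : ℂ) : ℂ :=
  Complex.exp (b * w + Complex.I * (Complex.exp w ^ 3 / 3 + θ * Complex.exp w))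

lemma differentiable_langerKernel (b θ : ℝ) : Differentiable ℂ (langerKernel b θ) := by
  unfold langerKernel
  fun_prop

lemma norm_langerKernel (b θ x y : ℝ) :
    ‖langerKernel b θ (x + y * Complex.I)‖ =
      rexp (b * x - (rexp x ^ 3 * sin (3 * y) / 3 + θ * (rexp x * sin y))) := by
  have h3 : Complex.exp (x + y * Complex.I) ^ 3 =
      Complex.exp ((3 * x : ℝ) + (3 * y : ℝ) * Complex.I) := by
    rw [← Complex.exp_nat_mul]
    congr 1
    push_cast
    ring
  rw [langerKernel, Complex.norm_exp, h3, ← Real.exp_nat_mul]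
  congr 1
  have hd (z : ℂ) : (z / 3).im = z.im / 3 := by simp
  simp [Complex.exp_im, hd]
  ring

/-- The factor `i * exp (i * π / 6)` of `θ * s` in the exponent after rotating the contour to the
ray of argument `π / 6`. It is a cube root of unity. -/
noncomputable def langerDir : ℂ := Complex.I * Complex.exp ((π / 6 : ℝ) * Complex.I)

lemma exp_pi_div_six_mul_I_pow_three :
    Complex.exp ((π / 6 : ℝ) * Complex.I) ^ 3 = Complex.I := by
  rw [← Complex.exp_nat_mul]
  refine Eq.trans (congrArg Complex.exp ?_) Complex.exp_pi_div_two_mul_I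
  push_cast
  ring

lemma langerDir_pow_three : langerDir ^ 3 = 1 := by
  rw [langerDir, mul_pow, exp_pi_div_six_mul_I_pow_three, ← pow_succ, Complex.I_pow_four]

lemma langerKernel_add_pi_div_six (b θ x : ℝ) :
    langerKernel b θ (x + (π / 6 : ℝ) * Complex.I) =
      Complex.exp (b * ((π / 6 : ℝ) * Complex.I)) *
        cubicLaplaceKernel b (langerDir * θ) x := by
  rw [langerKernel, cubicLaplaceKernel, ← Complex.exp_add, Complex.exp_add x, mul_pow,
    exp_pi_div_six_mul_I_pow_three, langerDir]
  congr 1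
  push_cast
  linear_combination (Complex.exp x ^ 3 / 3) * Complex.I_sq

lemma tendsto_integral_langerKernel_left {b : ℝ} (hb : 0 < b) (θ : ℝ) :
    Tendsto (fun B : ℝ => ∫ y in (0 : ℝ)..π / 6, langerKernel b θ ((-B : ℝ) + y * Complex.I))
      atTop (nhds 0) := by
  have hlim : Tendsto (fun B : ℝ => rexp (-(b * B) + |θ|) * |π / 6 - 0|) atTop (nhds 0) := by
    have h : Tendsto (fun B : ℝ => -(b * B) + |θ|) atTop atBot :=
      tendsto_atBot_add_const_right _ _
        (tendsto_neg_atTop_atBot.comp (tendsto_id.const_mul_atTop hb))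
    simpa only [zero_mul] using! (Real.tendsto_exp_atBot.comp h).mul_const |π / 6 - 0|
  refine squeeze_zero_norm' ?_ hlim
  filter_upwards [eventually_ge_atTop 0] with B hB
  refine intervalIntegral.norm_integral_le_of_norm_le_const fun y hy => ?_
  have hpi := Real.pi_pos
  rw [Set.uIoc_of_le (by positivity)] at hy
  rw [norm_langerKernel, Real.exp_le_exp]
  have h3 : 0 ≤ rexp (-B) ^ 3 * sin (3 * y) / 3 := by
    have : 0 ≤ sin (3 * y) := sin_nonneg_of_nonneg_of_le_pi (by linarith [hy.1])
      (by linarith [hy.2])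
    positivity
  have h1 : |θ * (rexp (-B) * sin y)| ≤ |θ| * 1 := by
    rw [abs_mul, abs_mul, abs_of_pos (Real.exp_pos _)]
    gcongr
    exact mul_le_one₀ (Real.exp_le_one_iff.2 (by linarith)) (abs_nonneg _) (abs_sin_le_one y)
  linarith [neg_abs_le (θ * (rexp (-B) * sin y))]

lemma tendsto_integral_langerKernel_right {b : ℝ} (hb : b < 1) (θ : ℝ) :
    Tendsto (fun B : ℝ => ∫ y in (0 : ℝ)..π / 6, langerKernel b θ (B + y * Complex.I))
      atTop (nhds 0) := by
  have hlim : Tendsto (fun B : ℝ => rexp ((b - 1) * B)) atTop (nhds 0) :=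
    Real.tendsto_exp_atBot.comp (tendsto_id.const_mul_atTop_of_neg (by linarith))
  refine squeeze_zero_norm' ?_ hlim
  filter_upwards [Real.tendsto_exp_atTop.eventually_ge_atTop (3 * (1 + |θ|))] with B hB
  have hpi := Real.pi_pos
  have hT := Real.exp_pos B
  have hle : ∀ y ∈ Set.Ioc 0 (π / 6), ‖langerKernel b θ (B + y * Complex.I)‖ ≤
      rexp (b * B) * rexp (-rexp B * y) := by
    intro y hy
    rw [norm_langerKernel, ← Real.exp_add, Real.exp_le_exp]
    have h3 : y ≤ sin (3 * y) := by
      refine le_trans ?_ (mul_le_sin (by linarith [hy.1]) (by linarith [hy.2]))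
      rw [div_mul_eq_mul_div, le_div_iff₀ hpi]
      nlinarith [hy.1, Real.pi_le_four]
    have h1 : |θ * (rexp B * sin y)| ≤ |θ| * (rexp B * y) := by
      rw [abs_mul, abs_mul, abs_of_pos hT]
      gcongr
      exact abs_sin_le_abs.trans_eq (abs_of_pos hy.1)
    have h4 : (1 + |θ|) * (rexp B * y) ≤ rexp B ^ 3 * y / 3 := by
      have h5 : 3 * (1 + |θ|) ≤ rexp B ^ 2 := by nlinarith [abs_nonneg θ]
      nlinarith [mul_le_mul_of_nonneg_right h5 (mul_pos hT hy.1).le]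
    have h6 : rexp B ^ 3 * y ≤ rexp B ^ 3 * sin (3 * y) := by gcongr
    linarith [neg_abs_le (θ * (rexp B * sin y))]
  refine (intervalIntegral.norm_integral_le_of_norm_le (by positivity)
    (.of_forall hle) (Continuous.intervalIntegrable (by fun_prop) _ _)).trans ?_
  rw [intervalIntegral.integral_const_mul, intervalIntegral.integral_comp_mul_left rexp
    (neg_ne_zero.2 hT.ne'), integral_exp, mul_zero, Real.exp_zero, smul_eq_mul,
    show (b - 1) * B = b * B + -B by ring, Real.exp_add, Real.exp_neg B]
  gcongr
  rw [inv_neg, neg_mul, ← mul_neg, neg_sub]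
  exact mul_le_of_le_one_right (by positivity) (by linarith [Real.exp_pos (-rexp B * (π / 6))])

lemma tendsto_integral_langerKernel {b : ℝ} (hb : b ∈ Set.Ioo (0 : ℝ) 1) (θ : ℝ) :
    Tendsto (fun B : ℝ => ∫ x in (-B)..B, langerKernel b θ x) atTop
      (nhds (Complex.exp (b * ((π / 6 : ℝ) * Complex.I)) * cubicLaplace b (langerDir * θ))) := by
  have htop := ((MeasureTheory.intervalIntegral_tendsto_integral
    (integrable_cubicLaplaceKernel hb.1 (langerDir * θ))
    tendsto_neg_atTop_atBot tendsto_id).const_mul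
      (Complex.exp (b * ((π / 6 : ℝ) * Complex.I))))
  have h := (htop.sub ((tendsto_integral_langerKernel_right hb.2 θ).const_mul Complex.I)).add
    ((tendsto_integral_langerKernel_left hb.1 θ).const_mul Complex.I)
  simp only [mul_zero, sub_zero, add_zero] at h
  refine h.congr fun B => ?_
  have hrect := Complex.integral_boundary_rect_eq_zero_of_differentiableOn (langerKernel b θ)
    ((-B : ℝ) : ℂ) (B + (π / 6 : ℝ) * Complex.I) (differentiable_langerKernel b θ).differentiableOn
  simp only [Complex.ofReal_re, Complex.ofReal_im, Complex.add_re, Complex.add_im,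
    Complex.re_ofReal_mul, Complex.im_ofReal_mul, Complex.I_re, Complex.I_im, mul_zero, mul_one,
    add_zero, zero_add, Complex.ofReal_zero, zero_mul, smul_eq_mul, langerKernel_add_pi_div_six,
    intervalIntegral.integral_const_mul, id] at hrect ⊢
  linear_combination -hrect

lemma langerIntegrand_comp_exp (ξ θ x : ℝ) :
    cos (rexp x ^ 3 / 3 + θ * rexp x + ξ * π / 2) * rexp x ^ (-ξ) * rexp x =
      (Complex.exp ((ξ * π / 2 : ℝ) * Complex.I) * langerKernel (1 - ξ) θ x).re := by
  have h : ((ξ * π / 2 : ℝ) : ℂ) * Complex.I + (((1 - ξ : ℝ) : ℂ) * x +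
      Complex.I * (Complex.exp x ^ 3 / 3 + θ * Complex.exp x)) =
      ((1 - ξ) * x : ℝ) + (rexp x ^ 3 / 3 + θ * rexp x + ξ * π / 2 : ℝ) * Complex.I := by
    push_cast
    ring
  rw [langerKernel, ← Complex.exp_add, h, Complex.exp_add, ← Complex.ofReal_exp,
    Complex.re_ofReal_mul, Complex.exp_ofReal_mul_I_re, ← Real.exp_mul, mul_assoc, ← Real.exp_add,
    mul_comm]
  ring_nf

lemma intervalIntegrable_langerIntegrand {ξ : ℝ} (hξ : ξ < 1) (θ a c : ℝ) :
    IntervalIntegrable (fun τ : ℝ => cos (τ ^ 3 / 3 + θ * τ + ξ * π / 2) * τ ^ (-ξ))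
      MeasureTheory.volume a c :=
  (intervalIntegral.intervalIntegrable_rpow' (by linarith)).continuousOn_mul (by fun_prop)

lemma integral_langerIntegrand_exp (ξ θ B : ℝ) :
    ∫ τ in rexp (-B)..rexp B, cos (τ ^ 3 / 3 + θ * τ + ξ * π / 2) * τ ^ (-ξ) =
      (Complex.exp ((ξ * π / 2 : ℝ) * Complex.I) *
        ∫ x in (-B)..B, langerKernel (1 - ξ) θ x).re := by
  rw [← intervalIntegral.integral_comp_mul_deriv' (fun x _ => Real.hasDerivAt_exp x)
    Real.continuous_exp.continuousOn, ← intervalIntegral.integral_const_mul, ← Complex.reCLM_apply,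
    ← Complex.reCLM.intervalIntegral_comp_comm]
  · exact intervalIntegral.integral_congr fun x _ => langerIntegrand_comp_exp ξ θ x
  · exact (continuous_const.mul ((differentiable_langerKernel _ θ).continuous.comp
      Complex.continuous_ofReal)).intervalIntegrable _ _
  · rintro _ ⟨x, -, rfl⟩
    refine ContinuousAt.continuousWithinAt (ContinuousAt.mul (by fun_prop) ?_)
    exact Real.continuousAt_rpow_const _ _ (.inl (Real.exp_pos x).ne')

/-- The coefficient `exp (i * ξ * π / 2) * exp (i * (1 - ξ) * π / 6)` of the rotated integral. -/
noncomputable def langerCoeff (ξ : ℝ) : ℂ :=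
  Complex.exp ((ξ * π / 2 : ℝ) * Complex.I) *
    Complex.exp ((1 - ξ : ℝ) * ((π / 6 : ℝ) * Complex.I))

lemma tendsto_integral_langerIntegrand {ξ : ℝ} (hξ : ξ ∈ Set.Ioo (0 : ℝ) 1) (θ : ℝ) :
    Tendsto (fun T : ℝ => ∫ τ in (0 : ℝ)..T,
        cos (τ ^ 3 / 3 + θ * τ + ξ * π / 2) * τ ^ (-ξ)) atTop
      (nhds (langerCoeff ξ * cubicLaplace (1 - ξ) (langerDir * θ)).re) := by
  have hint := intervalIntegrable_langerIntegrand hξ.2 θ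
  have hmain := (Complex.continuous_re.tendsto _).comp
    ((tendsto_integral_langerKernel (b := 1 - ξ) ⟨by linarith [hξ.2], by linarith [hξ.1]⟩
      θ).const_mul (Complex.exp ((ξ * π / 2 : ℝ) * Complex.I)))
  have hzero := ((intervalIntegral.continuous_primitive hint 0).tendsto 0).comp
    (Real.tendsto_exp_atBot.comp tendsto_neg_atTop_atBot)
  rw [intervalIntegral.integral_same] at hzero
  have hsum := (hzero.add hmain).comp Real.tendsto_log_atTop
  rw [zero_add, ← mul_assoc] at hsum
  refine hsum.congr' ?_
  filter_upwards [eventually_gt_atTop 0] with T hT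
  simp only [Function.comp_apply]
  rw [← integral_langerIntegrand_exp,
    intervalIntegral.integral_add_adjacent_intervals (hint _ _) (hint _ _), Real.exp_log hT]

lemma hasDerivAt_re_mul_cubicLaplace {b : ℝ} (hb : 0 < b) (k c : ℂ) (θ : ℝ) :
    HasDerivAt (fun t : ℝ => (k * cubicLaplace b (c * t)).re)
      (k * c * cubicLaplace (b + 1) (c * θ)).re θ := by
  have h : HasDerivAt (fun w : ℂ => k * cubicLaplace b (c * w))
      (k * c * cubicLaplace (b + 1) (c * θ)) (θ : ℂ) := by
    refine (((hasDerivAt_cubicLaplace hb (c * θ)).comp (θ : ℂ)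
      ((hasDerivAt_id (θ : ℂ)).const_mul c)).const_mul k).congr_deriv ?_
    ring
  exact h.real_of_complex

/-- For `ξ ∈ (0,1)`, the improper Riemann integral
`Lb_ξ(θ) = lim_{T→∞} ∫₀^T cos(τ³/3 + θτ + ξπ/2) τ^{−ξ} dτ` exists for every `θ`,
the resulting function is three times differentiable, and it solves Langer's
equation `Lb_ξ''' = θ·Lb_ξ' + (1−ξ)·Lb_ξ`. -/
theorem Lb_exists_and_solves_langer (ξ : ℝ) (hξ : ξ ∈ Set.Ioo (0 : ℝ) 1) :
    ∃ Lb : ℝ → ℝ,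
      (∀ θ : ℝ, Tendsto
        (fun T : ℝ => ∫ τ in (0 : ℝ)..T,
          Real.cos (τ ^ 3 / 3 + θ * τ + ξ * π / 2) * τ ^ (-ξ))
        atTop (nhds (Lb θ))) ∧
      Differentiable ℝ Lb ∧
      Differentiable ℝ (deriv Lb) ∧
      Differentiable ℝ (deriv (deriv Lb)) ∧
      ∀ θ : ℝ, deriv (deriv (deriv Lb)) θ = θ * deriv Lb θ + (1 - ξ) * Lb θ := by
  have hb : 0 < 1 - ξ := by linarith [hξ.2]
  have h0 := hasDerivAt_re_mul_cubicLaplace hb (langerCoeff ξ) langerDir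
  have h1 := hasDerivAt_re_mul_cubicLaplace (add_pos hb one_pos) (langerCoeff ξ * langerDir)
    langerDir
  have h2 := hasDerivAt_re_mul_cubicLaplace (add_pos (add_pos hb one_pos) one_pos)
    (langerCoeff ξ * langerDir * langerDir) langerDir
  refine ⟨fun t => (langerCoeff ξ * cubicLaplace (1 - ξ) (langerDir * t)).re,
    tendsto_integral_langerIntegrand hξ, fun θ => (h0 θ).differentiableAt, ?_⟩
  rw [deriv_eq h0, deriv_eq h1]
  refine ⟨fun θ => (h1 θ).differentiableAt, fun θ => (h2 θ).differentiableAt, fun θ => ?_⟩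
  rw [(h2 θ).deriv, show 1 - ξ + 1 + 1 + 1 = 1 - ξ + 3 by ring, cubicLaplace_add_three hb,
    ← Complex.re_ofReal_mul, ← Complex.re_ofReal_mul, ← Complex.add_re]
  congr 1
  linear_combination (langerCoeff ξ * (langerDir * θ * cubicLaplace (1 - ξ + 1) (langerDir * θ) +
    (1 - ξ : ℝ) * cubicLaplace (1 - ξ) (langerDir * θ))) * langerDir_pow_three
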